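/- Let n ≥ 1 and a_i^{(α)} ∈ ℂⁿ for i ∈ {1,2}, α ∈ {1,2,3,4}, and set F_i(z) = Σ_{α=1}^4 a_i^{(α)} z^α. Assume condition (A)₄ holds and condition (B)_{4,c} holds for some constant c > 0, and suppose a₁⁽⁴⁾ = μ·e₁ for some real μ > 0 (e₁ the first standard basis vector of ℂⁿ) and a₂⁽⁴⁾ = 0. Then the first coordinate of a₂⁽¹⁾ is zero. -/

import Mathlib

open scoped BigOperators
open Complex

noncomputable def hinner {m : ℕ} (u w : Fin m → ℂ) : ℂ :=
  ∑ i, u i * (starRingEnd ℂ) (w i)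

noncomputable def gram {m k : ℕ} (v : Fin k → Fin m → ℂ) : ℂ :=
  Matrix.det (Matrix.of fun i j : Fin k => hinner (v i) (v j))

noncomputable def vOne {n : ℕ} (F : ℂ → Fin n → ℂ) (z : ℂ) : Fin (n + 2) → ℂ :=
  Fin.cons 1 (Fin.cons 0 (F z))

noncomputable def vTwo {n : ℕ} (F : ℂ → Fin n → ℂ) (z : ℂ) : Fin (n + 2) → ℂ :=
  Fin.cons 0 (Fin.cons 1 (F z))

def IsPolyMap {n : ℕ} (F : ℂ → Fin n → ℂ) : Prop :=
  ∀ i : Fin n, ∃ p : Polynomial ℂ, ∀ z : ℂ, F z i = Polynomial.eval z p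

def CondA {n : ℕ} (d : ℕ) (F₁ F₂ : ℂ → Fin n → ℂ) : Prop :=
  ∀ z : ℂ,
    1 + hinner (F₁ z) (F₁ z) + hinner (F₂ z) (F₂ z) +
      (hinner (F₁ z) (F₁ z) * hinner (F₂ z) (F₂ z) -
        hinner (F₁ z) (F₂ z) * (starRingEnd ℂ) (hinner (F₁ z) (F₂ z))) =
    (1 + (Complex.normSq z : ℂ)) ^ d

def CondB {n : ℕ} (d : ℕ) (c : ℝ) (F₁ F₂ : ℂ → Fin n → ℂ) : Prop :=
  ∀ z : ℂ,
    gram ![vOne F₁ z, vTwo F₂ z, deriv (vOne F₁) z, deriv (vTwo F₂) z] =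
      (c : ℂ) * (1 + (Complex.normSq z : ℂ)) ^ (2 * d - 4)

noncomputable def F1t (t : ℝ) (z : ℂ) : Fin 4 → ℂ :=
  ![(|t - 2| : ℝ) * z ^ 3, (Real.sqrt t : ℝ) * z,
    ((Real.sqrt ((3 - t) / (4 - t)) * |t - 2| : ℝ)) * z ^ 2,
    ((Real.sqrt (t / (4 - t)) : ℝ)) * z ^ 2]

noncomputable def F2t (t : ℝ) (z : ℂ) : Fin 4 → ℂ :=
  ![(Real.sqrt (3 - t) : ℝ) * z ^ 2, 0, (Real.sqrt (4 - t) : ℝ) * z, 0]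

noncomputable def v1t (t : ℝ) (z : ℂ) : Fin 6 → ℂ := vOne (F1t t) z

noncomputable def v2t (t : ℝ) (z : ℂ) : Fin 6 → ℂ := vTwo (F2t t) z


theorem polar_aux (f : ℂ → ℂ) (hf : Differentiable ℂ f) (h : ∀ x : ℝ, f x = 0) : ∀ x, f x = 0 := by
  have h1 : AnalyticOnNhd ℂ f Set.univ := fun x _ => hf.analyticAt x
  have h2 : ∃ᶠ z in nhdsWithin (0:ℂ) {0}ᶜ, f z = (fun _ => (0:ℂ)) z := by
    have ht : Filter.Tendsto (fun x : ℝ => (x : ℂ)) (nhdsWithin (0:ℝ) {0}ᶜ) (nhdsWithin (0:ℂ) {0}ᶜ) := by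
      apply tendsto_nhdsWithin_of_tendsto_nhds_of_eventually_within
      · have : Filter.Tendsto (fun x : ℝ => (x : ℂ)) (nhds 0) (nhds ((0:ℝ):ℂ)) :=
          Complex.continuous_ofReal.tendsto 0
        simpa using this.mono_left nhdsWithin_le_nhds
      · filter_upwards [self_mem_nhdsWithin] with x hx
        simpa using hx
    apply ht.frequently
    apply Filter.Eventually.frequently
    exact Filter.Eventually.of_forall fun x => h x
  have h3 := h1.eqOn_of_preconnected_of_frequently_eq (g := fun _ => 0)
    (fun x _ => analyticAt_const) isPreconnected_univ (Set.mem_univ 0) h2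
  exact fun x => h3 (Set.mem_univ x)

theorem polar (f : ℂ → ℂ → ℂ) (hf : Differentiable ℂ (fun p : ℂ × ℂ => f p.1 p.2))
    (h : ∀ z, f z ((starRingEnd ℂ) z) = 0) : ∀ z w, f z w = 0 := by
  have key : ∀ x y : ℂ, f (x + I * y) (x - I * y) = 0 := by
    intro x y
    refine polar_aux (fun y => f (x + I * y) (x - I * y)) ?_ ?_ y
    · exact hf.comp (f := fun y : ℂ => ((x + I * y, x - I * y) : ℂ × ℂ)) (by fun_prop)
    · intro y
      refine polar_aux (fun x => f (x + I * y) (x - I * y)) ?_ ?_ x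
      · exact hf.comp (f := fun x : ℂ => ((x + I * y, x - I * y) : ℂ × ℂ)) (by fun_prop)
      · intro x
        have := h (x + I * y)
        simpa [sub_eq_add_neg] using this
  intro z w
  have := key ((z + w) / 2) ((z - w) / (2 * I))
  convert this using 1
  have : I ≠ 0 := I_ne_zero
  congr 1 <;> field_simp <;> ring

theorem coeffs (c0 c1 c2 c3 c4 c5 c6 c7 c8 : ℂ)
    (h : ∀ z : ℂ, c0 + c1 * z + c2 * z ^ 2 + c3 * z ^ 3 + c4 * z ^ 4 + c5 * z ^ 5 + c6 * z ^ 6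
      + c7 * z ^ 7 + c8 * z ^ 8 = 0) :
    c0 = 0 ∧ c1 = 0 ∧ c2 = 0 ∧ c3 = 0 ∧ c4 = 0 ∧ c5 = 0 ∧ c6 = 0 ∧ c7 = 0 ∧ c8 = 0 := by
  open Polynomial in
  have hp : (C c0 + C c1 * X + C c2 * X ^ 2 + C c3 * X ^ 3 + C c4 * X ^ 4 + C c5 * X ^ 5
      + C c6 * X ^ 6 + C c7 * X ^ 7 + C c8 * X ^ 8 : ℂ[X]) = 0 := by
    apply Polynomial.funext
    intro z
    simpa using h z
  have hc := fun k => congrArg (fun p => Polynomial.coeff p k) hp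
  refine ⟨?_, ?_, ?_, ?_, ?_, ?_, ?_, ?_, ?_⟩
  · simpa [Polynomial.coeff_X, Polynomial.coeff_X_pow, Polynomial.coeff_C] using hc 0
  · simpa [Polynomial.coeff_X, Polynomial.coeff_X_pow, Polynomial.coeff_C] using hc 1
  · simpa [Polynomial.coeff_X, Polynomial.coeff_X_pow, Polynomial.coeff_C] using hc 2
  · simpa [Polynomial.coeff_X, Polynomial.coeff_X_pow, Polynomial.coeff_C] using hc 3
  · simpa [Polynomial.coeff_X, Polynomial.coeff_X_pow, Polynomial.coeff_C] using hc 4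
  · simpa [Polynomial.coeff_X, Polynomial.coeff_X_pow, Polynomial.coeff_C] using hc 5
  · simpa [Polynomial.coeff_X, Polynomial.coeff_X_pow, Polynomial.coeff_C] using hc 6
  · simpa [Polynomial.coeff_X, Polynomial.coeff_X_pow, Polynomial.coeff_C] using hc 7
  · simpa [Polynomial.coeff_X, Polynomial.coeff_X_pow, Polynomial.coeff_C] using hc 8

/-- polynomial curve -/
def PP {n : ℕ} (a b c d : Fin n → ℂ) (z : ℂ) : Fin n → ℂ :=
  z • a + z ^ 2 • b + z ^ 3 • c + z ^ 4 • d

def PQ {n : ℕ} (a b c d : Fin n → ℂ) (z : ℂ) : Fin n → ℂ :=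
  a + (2 * z) • b + (3 * z ^ 2) • c + (4 * z ^ 3) • d

theorem hinner_eq {n : ℕ} (u v : Fin n → ℂ) : hinner u v = dotProduct u (star v) := rfl

theorem star_PP {n : ℕ} (a b c d : Fin n → ℂ) (z : ℂ) :
    star (PP a b c d z) = PP (star a) (star b) (star c) (star d) ((starRingEnd ℂ) z) := by
  ext i; simp [PP]

theorem star_PQ {n : ℕ} (a b c d : Fin n → ℂ) (z : ℂ) :
    star (PQ a b c d z) = PQ (star a) (star b) (star c) (star d) ((starRingEnd ℂ) z) := by
  ext i; simp [PQ]

theorem PP_dot {n : ℕ} (a b c d u : Fin n → ℂ) (z : ℂ) : dotProduct (PP a b c d z) u =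
    z * dotProduct a u + z ^ 2 * dotProduct b u + z ^ 3 * dotProduct c u + z ^ 4 * dotProduct d u := by
  simp [PP, add_dotProduct, smul_dotProduct]

theorem dot_PP {n : ℕ} (a b c d u : Fin n → ℂ) (z : ℂ) : dotProduct u (PP a b c d z) =
    z * dotProduct u a + z ^ 2 * dotProduct u b + z ^ 3 * dotProduct u c + z ^ 4 * dotProduct u d := by
  simp [PP, dotProduct_add, dotProduct_smul]

theorem PQ_dot {n : ℕ} (a b c d u : Fin n → ℂ) (z : ℂ) : dotProduct (PQ a b c d z) u =
    dotProduct a u + 2 * z * dotProduct b u + 3 * z ^ 2 * dotProduct c u + 4 * z ^ 3 * dotProduct d u := by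
  simp [PQ, add_dotProduct, smul_dotProduct]

theorem dot_PQ {n : ℕ} (a b c d u : Fin n → ℂ) (z : ℂ) : dotProduct u (PQ a b c d z) =
    dotProduct u a + 2 * z * dotProduct u b + 3 * z ^ 2 * dotProduct u c + 4 * z ^ 3 * dotProduct u d := by
  simp [PQ, dotProduct_add, dotProduct_smul]

theorem polarA {n : ℕ} (a11 a21 a12 a22 a13 a23 a14 a24 : Fin n → ℂ)
    (hA : CondA 4 (PP a11 a12 a13 a14) (PP a21 a22 a23 a24)) (z w : ℂ) :
    1 + dotProduct (PP a11 a12 a13 a14 z) (PP (star a11) (star a12) (star a13) (star a14) w)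
      + dotProduct (PP a21 a22 a23 a24 z) (PP (star a21) (star a22) (star a23) (star a24) w)
      + (dotProduct (PP a11 a12 a13 a14 z) (PP (star a11) (star a12) (star a13) (star a14) w)
        * dotProduct (PP a21 a22 a23 a24 z) (PP (star a21) (star a22) (star a23) (star a24) w)
        - dotProduct (PP a11 a12 a13 a14 z) (PP (star a21) (star a22) (star a23) (star a24) w)
        * dotProduct (PP a21 a22 a23 a24 z) (PP (star a11) (star a12) (star a13) (star a14) w))
      - (1 + z * w) ^ 4 = 0 := by
  revert z w
  apply polar
  · simp only [PP_dot, dot_PP]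
    fun_prop
  · intro z
    have h := hA z
    simp only [hinner_eq, star_PP] at h
    rw [sub_eq_zero, ← Complex.mul_conj] at *
    rw [← h]
    congr 3
    rw [starRingEnd_apply (dotProduct _ _), ← star_PP, ← star_PP]
    simp [dotProduct, mul_comm]

theorem deriv_vOne {n : ℕ} (a b c d : Fin n → ℂ) (z : ℂ) :
    deriv (vOne (PP a b c d)) z = Fin.cons 0 (Fin.cons 0 (PQ a b c d z)) := by
  apply HasDerivAt.deriv
  rw [hasDerivAt_pi]
  intro i
  refine Fin.cases ?_ (fun i => ?_) i
  · simpa [vOne] using hasDerivAt_const z (1:ℂ)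
  refine Fin.cases ?_ (fun i => ?_) i
  · simpa [vOne] using hasDerivAt_const z (0:ℂ)
  · simp only [vOne, Fin.cons_succ, PP, PQ, Pi.add_apply, Pi.smul_apply, smul_eq_mul]
    have := ((((hasDerivAt_id z).mul_const (a i)).add ((hasDerivAt_pow 2 z).mul_const (b i))).add
      ((hasDerivAt_pow 3 z).mul_const (c i))).add ((hasDerivAt_pow 4 z).mul_const (d i))
    convert this using 1
    · ext y; simp
    · simp

theorem deriv_vTwo {n : ℕ} (a b c d : Fin n → ℂ) (z : ℂ) :
    deriv (vTwo (PP a b c d)) z = Fin.cons 0 (Fin.cons 0 (PQ a b c d z)) := by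
  apply HasDerivAt.deriv
  rw [hasDerivAt_pi]
  intro i
  refine Fin.cases ?_ (fun i => ?_) i
  · simpa [vTwo] using hasDerivAt_const z (0:ℂ)
  refine Fin.cases ?_ (fun i => ?_) i
  · simpa [vTwo] using hasDerivAt_const z (1:ℂ)
  · simp only [vTwo, Fin.cons_succ, PP, PQ, Pi.add_apply, Pi.smul_apply, smul_eq_mul]
    have := ((((hasDerivAt_id z).mul_const (a i)).add ((hasDerivAt_pow 2 z).mul_const (b i))).add
      ((hasDerivAt_pow 3 z).mul_const (c i))).add ((hasDerivAt_pow 4 z).mul_const (d i))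
    convert this using 1
    · ext y; simp
    · simp

theorem hinner_cons {n : ℕ} (x y : ℂ) (u v : Fin n → ℂ) :
    hinner (Fin.cons x u : Fin (n+1) → ℂ) (Fin.cons y v) = x * (starRingEnd ℂ) y + hinner u v := by
  simp [hinner, Fin.sum_univ_succ]

theorem dPP {n : ℕ} (a b c d : Fin n → ℂ) : Differentiable ℂ (PP a b c d) := by
  unfold PP; fun_prop
theorem dPQ {n : ℕ} (a b c d : Fin n → ℂ) : Differentiable ℂ (PQ a b c d) := by
  unfold PQ; fun_prop
theorem dd {n : ℕ} (F G : ℂ → Fin n → ℂ) (hF : Differentiable ℂ F) (hG : Differentiable ℂ G) :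
    Differentiable ℂ fun p : ℂ × ℂ => dotProduct (F p.1) (G p.2) := by
  unfold dotProduct; fun_prop

theorem polarB {n : ℕ} (c : ℝ) (a11 a21 a12 a22 a13 a23 a14 a24 : Fin n → ℂ)
    (F1 F2 F3 F4 G1 G2 G3 G4 : ℂ → Fin n → ℂ)
    (hF1 : F1 = PP a11 a12 a13 a14) (hF2 : F2 = PP a21 a22 a23 a24)
    (hF3 : F3 = PQ a11 a12 a13 a14) (hF4 : F4 = PQ a21 a22 a23 a24)
    (hG1 : G1 = PP (star a11) (star a12) (star a13) (star a14))
    (hG2 : G2 = PP (star a21) (star a22) (star a23) (star a24))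
    (hG3 : G3 = PQ (star a11) (star a12) (star a13) (star a14))
    (hG4 : G4 = PQ (star a21) (star a22) (star a23) (star a24))
    (hB : CondB 4 c (PP a11 a12 a13 a14) (PP a21 a22 a23 a24)) (z w : ℂ) :
    Matrix.det !![1 + dotProduct (F1 z) (G1 w), dotProduct (F1 z) (G2 w), dotProduct (F1 z) (G3 w), dotProduct (F1 z) (G4 w);
      dotProduct (F2 z) (G1 w), 1 + dotProduct (F2 z) (G2 w), dotProduct (F2 z) (G3 w), dotProduct (F2 z) (G4 w);
      dotProduct (F3 z) (G1 w), dotProduct (F3 z) (G2 w), dotProduct (F3 z) (G3 w), dotProduct (F3 z) (G4 w);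
      dotProduct (F4 z) (G1 w), dotProduct (F4 z) (G2 w), dotProduct (F4 z) (G3 w), dotProduct (F4 z) (G4 w)]
      - c * (1 + z * w) ^ 4 = 0 := by
  revert z w
  apply polar
  · simp only [Matrix.det_apply]
    refine Differentiable.sub (Differentiable.fun_sum fun σ _ => ?_) (by fun_prop)
    refine Differentiable.const_smul ?_ _
    have key : ∀ (M : ℂ × ℂ → Matrix (Fin 4) (Fin 4) ℂ), (∀ i j, Differentiable ℂ fun p => M p i j) →
        Differentiable ℂ fun p => ∏ i, M p (σ i) i := by
      intro M hM
      simp only [Fin.prod_univ_four]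
      exact (((hM _ _).mul (hM _ _)).mul (hM _ _)).mul (hM _ _)
    apply key
    have hf1 : Differentiable ℂ F1 := hF1 ▸ dPP _ _ _ _
    have hf2 : Differentiable ℂ F2 := hF2 ▸ dPP _ _ _ _
    have hf3 : Differentiable ℂ F3 := hF3 ▸ dPQ _ _ _ _
    have hf4 : Differentiable ℂ F4 := hF4 ▸ dPQ _ _ _ _
    have hg1 : Differentiable ℂ G1 := hG1 ▸ dPP _ _ _ _
    have hg2 : Differentiable ℂ G2 := hG2 ▸ dPP _ _ _ _
    have hg3 : Differentiable ℂ G3 := hG3 ▸ dPQ _ _ _ _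
    have hg4 : Differentiable ℂ G4 := hG4 ▸ dPQ _ _ _ _
    clear hF1 hF2 hF3 hF4 hG1 hG2 hG3 hG4 hB
    intro i j
    fin_cases i <;> fin_cases j
    · exact (dd F1 G1 hf1 hg1).const_add 1
    · exact dd F1 G2 hf1 hg2
    · exact dd F1 G3 hf1 hg3
    · exact dd F1 G4 hf1 hg4
    · exact dd F2 G1 hf2 hg1
    · exact (dd F2 G2 hf2 hg2).const_add 1
    · exact dd F2 G3 hf2 hg3
    · exact dd F2 G4 hf2 hg4
    · exact dd F3 G1 hf3 hg1
    · exact dd F3 G2 hf3 hg2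
    · exact dd F3 G3 hf3 hg3
    · exact dd F3 G4 hf3 hg4
    · exact dd F4 G1 hf4 hg1
    · exact dd F4 G2 hf4 hg2
    · exact dd F4 G3 hf4 hg3
    · exact dd F4 G4 hf4 hg4
  · intro z
    have h := hB z
    rw [deriv_vOne, deriv_vTwo] at h
    rw [sub_eq_zero]
    subst hF1 hF2 hF3 hF4 hG1 hG2 hG3 hG4
    rw [← Complex.mul_conj] at h
    refine Eq.trans ?_ h
    unfold gram
    congr 1
    ext i j
    fin_cases i <;> fin_cases j <;> simp [vOne, vTwo, hinner_cons] <;> simp [hinner_eq, star_PP, star_PQ]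

open Polynomial in
theorem det_deriv (m : Fin 4 → Fin 4 → ℂ[X]) (h0 : ∀ j, j ≠ 0 → (m 0 j).eval 0 = 0)
    (h1 : ∀ j, j ≠ 1 → (m 1 j).eval 0 = 0) (h00 : (m 0 0).eval 0 = 1) (h11 : (m 1 1).eval 0 = 1)
    (h2 : ∀ j, (derivative (m 0 j)).eval 0 = (m 2 j).eval 0)
    (h3 : ∀ j, (derivative (m 1 j)).eval 0 = (m 3 j).eval 0) :
    (derivative (Matrix.det (Matrix.of m))).eval 0 =
      (derivative (m 2 2)).eval 0 * (m 3 3).eval 0 - (derivative (m 2 3)).eval 0 * (m 3 2).eval 0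
      + (m 2 2).eval 0 * (derivative (m 3 3)).eval 0 - (m 2 3).eval 0 * (derivative (m 3 2)).eval 0 := by
  have e1 := h0 1 (by decide)
  have e2 := h0 2 (by decide)
  have e3 := h0 3 (by decide)
  have e4 := h1 0 (by decide)
  have e5 := h1 2 (by decide)
  have e6 := h1 3 (by decide)
  have : Matrix.det (Matrix.of m) = 
      m 0 0 * (m 1 1 * (m 2 2 * m 3 3 - m 2 3 * m 3 2) - m 1 2 * (m 2 1 * m 3 3 - m 2 3 * m 3 1) + m 1 3 * (m 2 1 * m 3 2 - m 2 2 * m 3 1))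
      - m 0 1 * (m 1 0 * (m 2 2 * m 3 3 - m 2 3 * m 3 2) - m 1 2 * (m 2 0 * m 3 3 - m 2 3 * m 3 0) + m 1 3 * (m 2 0 * m 3 2 - m 2 2 * m 3 0))
      + m 0 2 * (m 1 0 * (m 2 1 * m 3 3 - m 2 3 * m 3 1) - m 1 1 * (m 2 0 * m 3 3 - m 2 3 * m 3 0) + m 1 3 * (m 2 0 * m 3 1 - m 2 1 * m 3 0))
      - m 0 3 * (m 1 0 * (m 2 1 * m 3 2 - m 2 2 * m 3 1) - m 1 1 * (m 2 0 * m 3 2 - m 2 2 * m 3 0) + m 1 2 * (m 2 0 * m 3 1 - m 2 1 * m 3 0)) := by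
    simp [Matrix.det_succ_row_zero, Fin.sum_univ_succ, Fin.succAbove]
    ring
  rw [this]
  simp only [derivative_sub, derivative_add, derivative_mul, eval_add, eval_sub, eval_mul, e1, e2, e3, e4, e5, e6, h00, h11, h2, h3]
  ring

open Polynomial in
theorem Bcoef (x y : Fin 4 → Fin 4 → ℂ) (c w : ℂ) (h : ∀ z : ℂ,
    Matrix.det !![1 + (z * x 0 0 + z ^ 2 * x 1 0 + z ^ 3 * x 2 0 + z ^ 4 * x 3 0),
      z * x 0 1 + z ^ 2 * x 1 1 + z ^ 3 * x 2 1 + z ^ 4 * x 3 1,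
      z * x 0 2 + z ^ 2 * x 1 2 + z ^ 3 * x 2 2 + z ^ 4 * x 3 2,
      z * x 0 3 + z ^ 2 * x 1 3 + z ^ 3 * x 2 3 + z ^ 4 * x 3 3;
      z * y 0 0 + z ^ 2 * y 1 0 + z ^ 3 * y 2 0 + z ^ 4 * y 3 0,
      1 + (z * y 0 1 + z ^ 2 * y 1 1 + z ^ 3 * y 2 1 + z ^ 4 * y 3 1),
      z * y 0 2 + z ^ 2 * y 1 2 + z ^ 3 * y 2 2 + z ^ 4 * y 3 2,
      z * y 0 3 + z ^ 2 * y 1 3 + z ^ 3 * y 2 3 + z ^ 4 * y 3 3;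
      x 0 0 + 2 * z * x 1 0 + 3 * z ^ 2 * x 2 0 + 4 * z ^ 3 * x 3 0,
      x 0 1 + 2 * z * x 1 1 + 3 * z ^ 2 * x 2 1 + 4 * z ^ 3 * x 3 1,
      x 0 2 + 2 * z * x 1 2 + 3 * z ^ 2 * x 2 2 + 4 * z ^ 3 * x 3 2,
      x 0 3 + 2 * z * x 1 3 + 3 * z ^ 2 * x 2 3 + 4 * z ^ 3 * x 3 3;
      y 0 0 + 2 * z * y 1 0 + 3 * z ^ 2 * y 2 0 + 4 * z ^ 3 * y 3 0,
      y 0 1 + 2 * z * y 1 1 + 3 * z ^ 2 * y 2 1 + 4 * z ^ 3 * y 3 1,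
      y 0 2 + 2 * z * y 1 2 + 3 * z ^ 2 * y 2 2 + 4 * z ^ 3 * y 3 2,
      y 0 3 + 2 * z * y 1 3 + 3 * z ^ 2 * y 2 3 + 4 * z ^ 3 * y 3 3] - c * (1 + z * w) ^ 4 = 0) :
    x 0 2 * y 0 3 - x 0 3 * y 0 2 = c ∧
    2 * (x 1 2 * y 0 3 - x 1 3 * y 0 2) + 2 * (x 0 2 * y 1 3 - x 0 3 * y 1 2) = 4 * c * w := by
  constructor
  · have h0 := h 0
    simp [Matrix.det_succ_row_zero, Fin.sum_univ_succ, Fin.succAbove] at h0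
    linear_combination h0
  · let p : (Fin 4 → Fin 4 → ℂ) → Fin 4 → ℂ[X] := fun x j =>
      X * C (x 0 j) + X ^ 2 * C (x 1 j) + X ^ 3 * C (x 2 j) + X ^ 4 * C (x 3 j)
    let q : (Fin 4 → Fin 4 → ℂ) → Fin 4 → ℂ[X] := fun x j =>
      C (x 0 j) + 2 * X * C (x 1 j) + 3 * X ^ 2 * C (x 2 j) + 4 * X ^ 3 * C (x 3 j)
    let m : Fin 4 → Fin 4 → ℂ[X] := ![![1 + p x 0, p x 1, p x 2, p x 3],
      ![p y 0, 1 + p y 1, p y 2, p y 3], q x, q y]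
    have hm : Matrix.det (Matrix.of m) = C c * (1 + X * C w) ^ 4 := by
      apply Polynomial.funext
      intro z
      have := h z
      rw [sub_eq_zero] at this
      rw [← coe_evalRingHom, RingHom.map_det]
      have e : (C c * (1 + X * C w) ^ 4).eval z = c * (1 + z * w) ^ 4 := by
        simp only [eval_mul, eval_C, eval_pow, eval_add, eval_one, eval_X]
      rw [coe_evalRingHom, e, ← this]
      congr 1
      ext i j
      fin_cases i <;> fin_cases j <;> simp [m, p, q] <;> ring
    have hd := det_deriv m (by intro j hj; fin_cases j <;> simp [m, p] at hj ⊢)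
      (by intro j hj; fin_cases j <;> simp [m, p] at hj ⊢) (by simp [m, p]) (by simp [m, p])
      (by intro j; fin_cases j <;> simp [m, p, q]) (by intro j; fin_cases j <;> simp [m, p, q])
    rw [hm] at hd
    simp [m, q, derivative_pow] at hd
    linear_combination -hd

theorem hinner_zero {n : ℕ} (a : Fin n → ℂ) : hinner a 0 = 0 := by simp [hinner]
theorem zero_hinner {n : ℕ} (a : Fin n → ℂ) : hinner 0 a = 0 := by simp [hinner]

theorem Az (x1 x2 x3 x4 y1 y2 y3 u1 u2 u3 u4 v1 v2 v3 w : ℂ)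
    (h : ∀ z : ℂ, 1 + (z * x1 + z ^ 2 * x2 + z ^ 3 * x3 + z ^ 4 * x4)
      + (z * v1 + z ^ 2 * v2 + z ^ 3 * v3 + z ^ 4 * 0)
      + ((z * x1 + z ^ 2 * x2 + z ^ 3 * x3 + z ^ 4 * x4) * (z * v1 + z ^ 2 * v2 + z ^ 3 * v3 + z ^ 4 * 0)
      - (z * u1 + z ^ 2 * u2 + z ^ 3 * u3 + z ^ 4 * u4) * (z * y1 + z ^ 2 * y2 + z ^ 3 * y3 + z ^ 4 * 0))
      - (1 + z * w) ^ 4 = 0) :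
    x1 + v1 - 4 * w = 0 ∧ x2 + v2 + (x1 * v1 - u1 * y1) - 6 * w ^ 2 = 0 ∧
    x3 + v3 + (x1 * v2 + x2 * v1 - u1 * y2 - u2 * y1) - 4 * w ^ 3 = 0 ∧
    x4 + (x1 * v3 + x2 * v2 + x3 * v1 - u1 * y3 - u2 * y2 - u3 * y1) - w ^ 4 = 0 ∧
    x2 * v3 + x3 * v2 + x4 * v1 - u2 * y3 - u3 * y2 - u4 * y1 = 0 ∧
    x3 * v3 + x4 * v2 - u3 * y3 - u4 * y2 = 0 ∧ x4 * v3 - u4 * y3 = 0 := by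
  have := coeffs 0 (x1 + v1 - 4 * w) (x2 + v2 + (x1 * v1 - u1 * y1) - 6 * w ^ 2)
    (x3 + v3 + (x1 * v2 + x2 * v1 - u1 * y2 - u2 * y1) - 4 * w ^ 3)
    (x4 + (x1 * v3 + x2 * v2 + x3 * v1 - u1 * y3 - u2 * y2 - u3 * y1) - w ^ 4)
    (x2 * v3 + x3 * v2 + x4 * v1 - u2 * y3 - u3 * y2 - u4 * y1)
    (x3 * v3 + x4 * v2 - u3 * y3 - u4 * y2) (x4 * v3 - u4 * y3) 0
    (fun z => by linear_combination h z)
  tauto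

/-- polarized pairing with F -/
noncomputable def L {n : ℕ} (a b c d : Fin n → ℂ) (w : ℂ) (x : Fin n → ℂ) : ℂ :=
  w * hinner x a + w ^ 2 * hinner x b + w ^ 3 * hinner x c + w ^ 4 * hinner x d
noncomputable def L' {n : ℕ} (a b c d : Fin n → ℂ) (w : ℂ) (x : Fin n → ℂ) : ℂ :=
  hinner x a + 2 * w * hinner x b + 3 * w ^ 2 * hinner x c + 4 * w ^ 3 * hinner x d

theorem AzL {n : ℕ} (a11 a21 a12 a22 a13 a23 a14 : Fin n → ℂ)
    (hA : CondA 4 (PP a11 a12 a13 a14) (PP a21 a22 a23 0)) (w : ℂ)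
    (G1 G2 : (Fin n → ℂ) → ℂ) (hG1 : G1 = L a11 a12 a13 a14 w) (hG2 : G2 = L a21 a22 a23 0 w) :
    G1 a11 + G2 a21 - 4 * w = 0 ∧ G1 a12 + G2 a22 + (G1 a11 * G2 a21 - G2 a11 * G1 a21) - 6 * w ^ 2 = 0 ∧
    G1 a13 + G2 a23 + (G1 a11 * G2 a22 + G1 a12 * G2 a21 - G2 a11 * G1 a22 - G2 a12 * G1 a21) - 4 * w ^ 3 = 0 ∧
    G1 a14 + (G1 a11 * G2 a23 + G1 a12 * G2 a22 + G1 a13 * G2 a21 - G2 a11 * G1 a23 - G2 a12 * G1 a22 - G2 a13 * G1 a21) - w ^ 4 = 0 ∧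
    G1 a12 * G2 a23 + G1 a13 * G2 a22 + G1 a14 * G2 a21 - G2 a12 * G1 a23 - G2 a13 * G1 a22 - G2 a14 * G1 a21 = 0 ∧
    G1 a13 * G2 a23 + G1 a14 * G2 a22 - G2 a13 * G1 a23 - G2 a14 * G1 a22 = 0 ∧ G1 a14 * G2 a23 - G2 a14 * G1 a23 = 0 := by
  apply Az
  intro z
  have h := polarA _ _ _ _ _ _ _ _ hA z w
  simp only [PP_dot, zero_dotProduct] at h
  simp only [dot_PP, ← hinner_eq] at h
  subst hG1 hG2
  exact h

theorem Apoly {n : ℕ} (a11 a21 a12 a22 a13 a23 a14 : Fin n → ℂ)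
    (hA : CondA 4 (PP a11 a12 a13 a14) (PP a21 a22 a23 0)) :
    (hinner a11 a11) + (hinner a21 a21) + (-4) = 0 ∧
    (hinner a11 a12) + (hinner a21 a22) = 0 ∧
    (hinner a11 a13) + (hinner a21 a23) = 0 ∧
    (hinner a11 a14) = 0 ∧
    (hinner a12 a12) + (hinner a22 a22) + ((hinner a11 a11) * (hinner a21 a21)) + -((hinner a11 a21) * (hinner a21 a11)) + (-6) = 0 ∧
    ((hinner a12 a12) * (hinner a23 a23)) + ((hinner a12 a13) * (hinner a23 a22)) + ((hinner a12 a14) * (hinner a23 a21)) + -((hinner a12 a21) * (hinner a23 a14)) + -((hinner a12 a22) * (hinner a23 a13)) + -((hinner a12 a23) * (hinner a23 a12)) + ((hinner a13 a12) * (hinner a22 a23)) + ((hinner a13 a13) * (hinner a22 a22)) + ((hinner a13 a14) * (hinner a22 a21)) + -((hinner a13 a21) * (hinner a22 a14)) + -((hinner a13 a22) * (hinner a22 a13)) + -((hinner a13 a23) * (hinner a22 a12)) + ((hinner a14 a12) * (hinner a21 a23)) + ((hinner a14 a13) * (hinner a21 a22)) + ((hinner a14 a14) * (hinner a21 a21))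 + -((hinner a14 a21) * (hinner a21 a14)) + -((hinner a14 a22) * (hinner a21 a13)) + -((hinner a14 a23) * (hinner a21 a12)) = 0 ∧
    ((hinner a13 a13) * (hinner a23 a23)) + ((hinner a13 a14) * (hinner a23 a22)) + -((hinner a13 a22) * (hinner a23 a14)) + -((hinner a13 a23) * (hinner a23 a13)) + ((hinner a14 a13) * (hinner a22 a23)) + ((hinner a14 a14) * (hinner a22 a22)) + -((hinner a14 a22) * (hinner a22 a14)) + -((hinner a14 a23) * (hinner a22 a13)) = 0 ∧
    ((hinner a14 a14) * (hinner a23 a23)) + -((hinner a14 a23) * (hinner a23 a14)) = 0 := by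
  have hz := fun w => AzL _ _ _ _ _ _ _ hA w _ _ rfl rfl
  simp only [L, hinner_zero, mul_zero, add_zero] at hz
  have p1 := coeffs (0) ((hinner a11 a11) + (hinner a21 a21) + (-4)) ((hinner a11 a12) + (hinner a21 a22)) ((hinner a11 a13) + (hinner a21 a23)) ((hinner a11 a14)) (0) (0) (0) (0) (fun w => by linear_combination (hz w).1)
  have p2 := coeffs (0) ((hinner a12 a11) + (hinner a22 a21)) ((hinner a12 a12) + (hinner a22 a22) + ((hinner a11 a11) * (hinner a21 a21)) + -((hinner a11 a21) * (hinner a21 a11)) + (-6)) ((hinner a12 a13) + (hinner a22 a23) + ((hinner a11 a11) * (hinner a21 a22)) + ((hinner a11 a12) * (hinner a21 a21)) + -((hinner a11 a21) * (hinner a21 a12)) + -((hinner a11 a22) * (hinner a21 a11))) ((hinner a12 a14) + ((hinner a11 a11) * (hinner a21 a23)) + ((hinner a11 a12) * (hinner a21 a22)) + ((hinner a11 a13) * (hinner a21 a21)) + -((hinner a11 a21) * (hinner a21 a13)) + -((hinner a11 a22) * (hinner a21 a12)) + -((hinner a11 a23) * (hinner a21 a11))) (((hinner a11 a12) * (hinner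 a21 a23)) + ((hinner a11 a13) * (hinner a21 a22)) + ((hinner a11 a14) * (hinner a21 a21)) + -((hinner a11 a21) * (hinner a21 a14)) + -((hinner a11 a22) * (hinner a21 a13)) + -((hinner a11 a23) * (hinner a21 a12))) (((hinner a11 a13) * (hinner a21 a23)) + ((hinner a11 a14) * (hinner a21 a22)) + -((hinner a11 a22) * (hinner a21 a14)) + -((hinner a11 a23) * (hinner a21 a13))) (((hinner a11 a14) * (hinner a21 a23)) + -((hinner a11 a23) * (hinner a21 a14))) (0) (fun w => by linear_combination (hz w).2.1)
  have p5 := coeffs (0) (0) (((hinner a12 a11) * (hinner a23 a21)) + -((hinner a12 a21) * (hinner a23 a11)) + ((hinner a13 a11) * (hinner a22 a21)) + -((hinner a13 a21) * (hinner a22 a11)) + ((hinner a14 a11) * (hinner a21 a21)) + -((hinner a14 a21) * (hinner a21 a11))) (((hinner a12 a11) * (hinner a23 a22)) + ((hinner a12 a12) * (hinner a23 a21)) + -((hinner a12 a21) * (hinner a23 a12)) + -((hinner a12 a22) * (hinner a23 a11)) + ((hinner a13 a11) * (hinner a22 a22)) + ((hinner a13 a12) * (hinner a22 a21)) + -((hinner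 a13 a21) * (hinner a22 a12)) + -((hinner a13 a22) * (hinner a22 a11)) + ((hinner a14 a11) * (hinner a21 a22)) + ((hinner a14 a12) * (hinner a21 a21)) + -((hinner a14 a21) * (hinner a21 a12)) + -((hinner a14 a22) * (hinner a21 a11))) (((hinner a12 a11) * (hinner a23 a23)) + ((hinner a12 a12) * (hinner a23 a22)) + ((hinner a12 a13) * (hinner a23 a21)) + -((hinner a12 a21) * (hinner a23 a13)) + -((hinner a12 a22) * (hinner a23 a12)) + -((hinner a12 a23) * (hinner a23 a11)) + ((hinner a13 a11) * (hinner a22 a23)) + ((hinner a13 a12) * (hinner a22 a22)) + ((hinner a13 a13) * (hinner a22 a21)) + -((hinner a13 a21) * (hinner a22 a13)) + -((hinner a13 a22) * (hinner a22 a12)) + -((hinner a13 a23) * (hinner a22 a11)) + ((hinner a14 a11) * (hinner a21 a23)) + ((hinner a14 a12) * (hinner a21 a22)) + ((hinner a14 a13) * (hinner a21 a21)) + -((hinner a14 a21) * (hinner a21 a13)) + -((hinner a14 a22) * (hinner a21 a12)) + -((hinner a14 a23) * (hinner a21 a11))) (((hinner a12 a12) * (hinner a23 a23)) + ((hinner a12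 a13) * (hinner a23 a22)) + ((hinner a12 a14) * (hinner a23 a21)) + -((hinner a12 a21) * (hinner a23 a14)) + -((hinner a12 a22) * (hinner a23 a13)) + -((hinner a12 a23) * (hinner a23 a12)) + ((hinner a13 a12) * (hinner a22 a23)) + ((hinner a13 a13) * (hinner a22 a22)) + ((hinner a13 a14) * (hinner a22 a21)) + -((hinner a13 a21) * (hinner a22 a14)) + -((hinner a13 a22) * (hinner a22 a13)) + -((hinner a13 a23) * (hinner a22 a12)) + ((hinner a14 a12) * (hinner a21 a23)) + ((hinner a14 a13) * (hinner a21 a22)) + ((hinner a14 a14) * (hinner a21 a21)) + -((hinner a14 a21) * (hinner a21 a14)) + -((hinner a14 a22) * (hinner a21 a13)) + -((hinner a14 a23) * (hinner a21 a12))) (((hinner a12 a13) * (hinner a23 a23)) + ((hinner a12 a14) * (hinner a23 a22)) + -((hinner a12 a22) * (hinner a23 a14)) + -((hinner a12 a23) * (hinner a23 a13)) + ((hinner a13 a13) * (hinner a22 a23)) + ((hinner a13 a14) * (hinner a22 a22)) + -((hinner a13 a22) * (hinner a22 a14)) + -((hinner a13 a23) * (hinner a22 a13)) + ((hinner a14 a13)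 * (hinner a21 a23)) + ((hinner a14 a14) * (hinner a21 a22)) + -((hinner a14 a22) * (hinner a21 a14)) + -((hinner a14 a23) * (hinner a21 a13))) (((hinner a12 a14) * (hinner a23 a23)) + -((hinner a12 a23) * (hinner a23 a14)) + ((hinner a13 a14) * (hinner a22 a23)) + -((hinner a13 a23) * (hinner a22 a14)) + ((hinner a14 a14) * (hinner a21 a23)) + -((hinner a14 a23) * (hinner a21 a14))) (0) (fun w => by linear_combination (hz w).2.2.2.2.1)
  have p6 := coeffs (0) (0) (((hinner a13 a11) * (hinner a23 a21)) + -((hinner a13 a21) * (hinner a23 a11)) + ((hinner a14 a11) * (hinner a22 a21)) + -((hinner a14 a21) * (hinner a22 a11))) (((hinner a13 a11) * (hinner a23 a22)) + ((hinner a13 a12) * (hinner a23 a21)) + -((hinner a13 a21) * (hinner a23 a12)) + -((hinner a13 a22) * (hinner a23 a11)) + ((hinner a14 a11) * (hinner a22 a22)) + ((hinner a14 a12) * (hinner a22 a21)) + -((hinner a14 a21) * (hinner a22 a12)) + -((hinner a14 a22) * (hinner a22 a11))) (((hinner a13 a11) * (hinner a23 a23)) + ((hinner a13 a12) * (hinner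 a23 a22)) + ((hinner a13 a13) * (hinner a23 a21)) + -((hinner a13 a21) * (hinner a23 a13)) + -((hinner a13 a22) * (hinner a23 a12)) + -((hinner a13 a23) * (hinner a23 a11)) + ((hinner a14 a11) * (hinner a22 a23)) + ((hinner a14 a12) * (hinner a22 a22)) + ((hinner a14 a13) * (hinner a22 a21)) + -((hinner a14 a21) * (hinner a22 a13)) + -((hinner a14 a22) * (hinner a22 a12)) + -((hinner a14 a23) * (hinner a22 a11))) (((hinner a13 a12) * (hinner a23 a23)) + ((hinner a13 a13) * (hinner a23 a22)) + ((hinner a13 a14) * (hinner a23 a21)) + -((hinner a13 a21) * (hinner a23 a14)) + -((hinner a13 a22) * (hinner a23 a13)) + -((hinner a13 a23) * (hinner a23 a12)) + ((hinner a14 a12) * (hinner a22 a23)) + ((hinner a14 a13) * (hinner a22 a22)) + ((hinner a14 a14) * (hinner a22 a21)) + -((hinner a14 a21) * (hinner a22 a14)) + -((hinner a14 a22) * (hinner a22 a13)) + -((hinner a14 a23) * (hinner a22 a12))) (((hinner a13 a13) * (hinner a23 a23)) + ((hinner a13 a14) * (hinner a23 a22)) + -((hinner a13 a22) * (hinner a23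 a14)) + -((hinner a13 a23) * (hinner a23 a13)) + ((hinner a14 a13) * (hinner a22 a23)) + ((hinner a14 a14) * (hinner a22 a22)) + -((hinner a14 a22) * (hinner a22 a14)) + -((hinner a14 a23) * (hinner a22 a13))) (((hinner a13 a14) * (hinner a23 a23)) + -((hinner a13 a23) * (hinner a23 a14)) + ((hinner a14 a14) * (hinner a22 a23)) + -((hinner a14 a23) * (hinner a22 a14))) (0) (fun w => by linear_combination (hz w).2.2.2.2.2.1)
  have p7 := coeffs (0) (0) (((hinner a14 a11) * (hinner a23 a21)) + -((hinner a14 a21) * (hinner a23 a11))) (((hinner a14 a11) * (hinner a23 a22)) + ((hinner a14 a12) * (hinner a23 a21)) + -((hinner a14 a21) * (hinner a23 a12)) + -((hinner a14 a22) * (hinner a23 a11))) (((hinner a14 a11) * (hinner a23 a23)) + ((hinner a14 a12) * (hinner a23 a22)) + ((hinner a14 a13) * (hinner a23 a21)) + -((hinner a14 a21) * (hinner a23 a13)) + -((hinner a14 a22) * (hinner a23 a12)) + -((hinner a14 a23) * (hinner a23 a11))) (((hinner a14 a12) * (hinner a23 a23)) + ((hinner a14 a13) * (hinner a23 a22)) +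 ((hinner a14 a14) * (hinner a23 a21)) + -((hinner a14 a21) * (hinner a23 a14)) + -((hinner a14 a22) * (hinner a23 a13)) + -((hinner a14 a23) * (hinner a23 a12))) (((hinner a14 a13) * (hinner a23 a23)) + ((hinner a14 a14) * (hinner a23 a22)) + -((hinner a14 a22) * (hinner a23 a14)) + -((hinner a14 a23) * (hinner a23 a13))) (((hinner a14 a14) * (hinner a23 a23)) + -((hinner a14 a23) * (hinner a23 a14))) (0) (fun w => by linear_combination (hz w).2.2.2.2.2.2)
  exact ⟨p1.2.1, p1.2.2.1, p1.2.2.2.1, p1.2.2.2.2.1, p2.2.2.1, p5.2.2.2.2.2.1, p6.2.2.2.2.2.2.1, p7.2.2.2.2.2.2.2.1⟩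

theorem BzL {n : ℕ} (c : ℝ) (a11 a21 a12 a22 a13 a23 a14 : Fin n → ℂ)
    (hB : CondB 4 c (PP a11 a12 a13 a14) (PP a21 a22 a23 0)) (w : ℂ)
    (G3 G4 : (Fin n → ℂ) → ℂ) (hG3 : G3 = L' a11 a12 a13 a14 w) (hG4 : G4 = L' a21 a22 a23 0 w) :
    G3 a11 * G4 a21 - G4 a11 * G3 a21 = c ∧
    2 * (G3 a12 * G4 a21 - G4 a12 * G3 a21) + 2 * (G3 a11 * G4 a22 - G4 a11 * G3 a22) = 4 * c * w := by
  let a : Fin 4 → Fin n → ℂ := ![a11, a12, a13, a14]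
  let b : Fin 4 → Fin n → ℂ := ![a21, a22, a23, 0]
  let g : (Fin n → ℂ) → Fin 4 → ℂ := fun x => ![L a11 a12 a13 a14 w x, L a21 a22 a23 0 w x, G3 x, G4 x]
  have := Bcoef (fun i j => g (a i) j) (fun i j => g (b i) j) c w (by
    intro z
    have h := polarB c _ _ _ _ _ _ _ _ _ _ _ _ _ _ _ _ rfl rfl rfl rfl rfl rfl rfl rfl hB z w
    simp only [PP_dot, PQ_dot] at h
    simp only [dot_PP, dot_PQ, ← hinner_eq] at h
    subst hG3 hG4
    exact h)
  exact this

theorem Bpoly {n : ℕ} (c : ℝ) (a11 a21 a12 a22 a13 a23 a14 : Fin n → ℂ)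
    (hB : CondB 4 c (PP a11 a12 a13 a14) (PP a21 a22 a23 0)) :
    (1 * (hinner a11 a11) * 1 * (hinner a21 a21)) + -(1 * (hinner a11 a21) * 1 * (hinner a21 a11)) + (-c) = 0 ∧
    (1 * (hinner a11 a11) * 2 * (hinner a21 a22)) + (2 * (hinner a11 a12) * 1 * (hinner a21 a21)) + -(1 * (hinner a11 a21) * 2 * (hinner a21 a12)) + -(2 * (hinner a11 a22) * 1 * (hinner a21 a11)) = 0 ∧
    (3 * (hinner a11 a13) * 3 * (hinner a21 a23)) + (4 * (hinner a11 a14) * 2 * (hinner a21 a22)) + -(2 * (hinner a11 a22) * 4 * (hinner a21 a14)) + -(3 * (hinner a11 a23) * 3 * (hinner a21 a13)) = 0 ∧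
    2 * (1 * (hinner a12 a11) * 2 * (hinner a21 a22)) + 2 * (2 * (hinner a12 a12) * 1 * (hinner a21 a21)) + -2 * (1 * (hinner a12 a21) * 2 * (hinner a21 a12)) + -2 * (2 * (hinner a12 a22) * 1 * (hinner a21 a11)) + 2 * (1 * (hinner a11 a11) * 2 * (hinner a22 a22)) + 2 * (2 * (hinner a11 a12) * 1 * (hinner a22 a21)) + -2 * (1 * (hinner a11 a21) * 2 * (hinner a22 a12)) + -2 * (2 * (hinner a11 a22) * 1 * (hinner a22 a11)) + (-4 * c) = 0 := by
  have hz := fun w => BzL c _ _ _ _ _ _ _ hB w _ _ rfl rfl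
  simp only [L', hinner_zero, mul_zero, add_zero] at hz
  have p1 := coeffs ((1 * (hinner a11 a11) * 1 * (hinner a21 a21)) + -(1 * (hinner a11 a21) * 1 * (hinner a21 a11)) + (-c)) ((1 * (hinner a11 a11) * 2 * (hinner a21 a22)) + (2 * (hinner a11 a12) * 1 * (hinner a21 a21)) + -(1 * (hinner a11 a21) * 2 * (hinner a21 a12)) + -(2 * (hinner a11 a22) * 1 * (hinner a21 a11))) ((1 * (hinner a11 a11) * 3 * (hinner a21 a23)) + (2 * (hinner a11 a12) * 2 * (hinner a21 a22)) + (3 * (hinner a11 a13) * 1 * (hinner a21 a21)) + -(1 * (hinner a11 a21) * 3 * (hinner a21 a13)) + -(2 * (hinner a11 a22) * 2 * (hinner a21 a12)) + -(3 * (hinner a11 a23) * 1 * (hinner a21 a11))) ((2 * (hinner a11 a12) * 3 * (hinner a21 a23)) + (3 * (hinner a11 a13) * 2 * (hinner a21 a22)) + (4 * (hinner a11 a14) * 1 * (hinner a21 a21)) + -(1 * (hinner a11 a21) * 4 * (hinner a21 a14)) + -(2 * (hinner a11 a22) * 3 * (hinner a21 a13)) + -(3 * (hinner a11 a23) * 2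 * (hinner a21 a12))) ((3 * (hinner a11 a13) * 3 * (hinner a21 a23)) + (4 * (hinner a11 a14) * 2 * (hinner a21 a22)) + -(2 * (hinner a11 a22) * 4 * (hinner a21 a14)) + -(3 * (hinner a11 a23) * 3 * (hinner a21 a13))) ((4 * (hinner a11 a14) * 3 * (hinner a21 a23)) + -(3 * (hinner a11 a23) * 4 * (hinner a21 a14))) (0) (0) (0) (fun w => by linear_combination (hz w).1)
  have p2 := coeffs (2 * (1 * (hinner a12 a11) * 1 * (hinner a21 a21)) + -2 * (1 * (hinner a12 a21) * 1 * (hinner a21 a11)) + 2 * (1 * (hinner a11 a11) * 1 * (hinner a22 a21)) + -2 * (1 * (hinner a11 a21) * 1 * (hinner a22 a11))) (2 * (1 * (hinner a12 a11) * 2 * (hinner a21 a22)) + 2 * (2 * (hinner a12 a12) * 1 * (hinner a21 a21)) + -2 * (1 * (hinner a12 a21) * 2 * (hinner a21 a12)) + -2 * (2 * (hinner a12 a22) * 1 * (hinner a21 a11)) + 2 * (1 * (hinner a11 a11) * 2 * (hinner a22 a22)) + 2 * (2 * (hinner a11 a12) * 1 * (hinner a22 a21)) + -2 * (1 * (hinner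 a11 a21) * 2 * (hinner a22 a12)) + -2 * (2 * (hinner a11 a22) * 1 * (hinner a22 a11)) + (-4 * c)) (2 * (1 * (hinner a12 a11) * 3 * (hinner a21 a23)) + 2 * (2 * (hinner a12 a12) * 2 * (hinner a21 a22)) + 2 * (3 * (hinner a12 a13) * 1 * (hinner a21 a21)) + -2 * (1 * (hinner a12 a21) * 3 * (hinner a21 a13)) + -2 * (2 * (hinner a12 a22) * 2 * (hinner a21 a12)) + -2 * (3 * (hinner a12 a23) * 1 * (hinner a21 a11)) + 2 * (1 * (hinner a11 a11) * 3 * (hinner a22 a23)) + 2 * (2 * (hinner a11 a12) * 2 * (hinner a22 a22)) + 2 * (3 * (hinner a11 a13) * 1 * (hinner a22 a21)) + -2 * (1 * (hinner a11 a21) * 3 * (hinner a22 a13)) + -2 * (2 * (hinner a11 a22) * 2 * (hinner a22 a12)) + -2 * (3 * (hinner a11 a23) * 1 * (hinner a22 a11))) (2 * (2 * (hinner a12 a12) * 3 * (hinner a21 a23)) + 2 * (3 * (hinner a12 a13) * 2 * (hinner a21 a22)) + 2 * (4 * (hinner a12 a14) * 1 * (hinner a21 a21)) + -2 * (1 * (hinner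 a12 a21) * 4 * (hinner a21 a14)) + -2 * (2 * (hinner a12 a22) * 3 * (hinner a21 a13)) + -2 * (3 * (hinner a12 a23) * 2 * (hinner a21 a12)) + 2 * (2 * (hinner a11 a12) * 3 * (hinner a22 a23)) + 2 * (3 * (hinner a11 a13) * 2 * (hinner a22 a22)) + 2 * (4 * (hinner a11 a14) * 1 * (hinner a22 a21)) + -2 * (1 * (hinner a11 a21) * 4 * (hinner a22 a14)) + -2 * (2 * (hinner a11 a22) * 3 * (hinner a22 a13)) + -2 * (3 * (hinner a11 a23) * 2 * (hinner a22 a12))) (2 * (3 * (hinner a12 a13) * 3 * (hinner a21 a23)) + 2 * (4 * (hinner a12 a14) * 2 * (hinner a21 a22)) + -2 * (2 * (hinner a12 a22) * 4 * (hinner a21 a14)) + -2 * (3 * (hinner a12 a23) * 3 * (hinner a21 a13)) + 2 * (3 * (hinner a11 a13) * 3 * (hinner a22 a23)) + 2 * (4 * (hinner a11 a14) * 2 * (hinner a22 a22)) + -2 * (2 * (hinner a11 a22) * 4 * (hinner a22 a14)) + -2 * (3 * (hinner a11 a23) * 3 * (hinner a22 a13))) (2 * (4 * (hinner a12 a14)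 * 3 * (hinner a21 a23)) + -2 * (3 * (hinner a12 a23) * 4 * (hinner a21 a14)) + 2 * (4 * (hinner a11 a14) * 3 * (hinner a22 a23)) + -2 * (3 * (hinner a11 a23) * 4 * (hinner a22 a14))) (0) (0) (0) (fun w => by linear_combination (hz w).2)
  exact ⟨p1.1, p1.2.1, p1.2.2.2.2.1, p2.2.1⟩

theorem hinner_add_left {n : ℕ} (a b c : Fin n → ℂ) : hinner (a + b) c = hinner a c + hinner b c := by
  simp [hinner_eq, add_dotProduct]
theorem hinner_add_right {n : ℕ} (a b c : Fin n → ℂ) : hinner c (a + b) = hinner c a + hinner c b := by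
  simp [hinner_eq, dotProduct_add]
theorem hinner_sub_left {n : ℕ} (a b c : Fin n → ℂ) : hinner (a - b) c = hinner a c - hinner b c := by
  simp [hinner_eq, sub_dotProduct]
theorem hinner_sub_right {n : ℕ} (a b c : Fin n → ℂ) : hinner c (a - b) = hinner c a - hinner c b := by
  simp [hinner_eq, dotProduct_sub]
theorem hinner_smul_left {n : ℕ} (t : ℂ) (a c : Fin n → ℂ) : hinner (t • a) c = t * hinner a c := by
  simp [hinner_eq, smul_dotProduct]
theorem hinner_smul_right {n : ℕ} (t : ℂ) (a c : Fin n → ℂ) :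
    hinner c (t • a) = (starRingEnd ℂ) t * hinner c a := by
  simp [hinner_eq, dotProduct_smul]
theorem hinner_conj {n : ℕ} (a c : Fin n → ℂ) : (starRingEnd ℂ) (hinner a c) = hinner c a := by
  simp [hinner, mul_comm]
open scoped ComplexOrder in
theorem hinner_self {n : ℕ} (a : Fin n → ℂ) (h : hinner a a = 0) : a = 0 := by
  rw [hinner_eq] at h
  exact dotProduct_self_star_eq_zero.mp h

theorem wedge {n : ℕ} (e x : Fin n → ℂ) (he : hinner e e ≠ 0)
    (h : hinner e e * hinner x x - hinner e x * hinner x e = 0) : ∃ t : ℂ, x = t • e := by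
  refine ⟨hinner x e / hinner e e, ?_⟩
  rw [← sub_eq_zero]
  apply hinner_self
  simp only [hinner_sub_left, hinner_sub_right, hinner_smul_left, hinner_smul_right, map_div₀,
    hinner_conj]
  field_simp
  linear_combination h

theorem normSq_sum (a b : ℂ) (h : a * (starRingEnd ℂ) a + 2 * (b * (starRingEnd ℂ) b) = 0) : b = 0 := by
  rw [Complex.mul_conj, Complex.mul_conj] at h
  have h' : Complex.normSq a + 2 * Complex.normSq b = 0 := by exact_mod_cast h
  have := Complex.normSq_nonneg a
  have := Complex.normSq_nonneg b
  exact Complex.normSq_eq_zero.mp (by linarith)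

theorem caseZero {n : ℕ} (c : ℝ) (a11 a12 a13 a14 : Fin n → ℂ) (l : ℂ)
    (he : hinner a14 a14 ≠ 0) (hl : l ≠ 0)
    (hA : CondA 4 (PP a11 a12 a13 a14) (PP (l • a14) 0 0 0))
    (hB : CondB 4 c (PP a11 a12 a13 a14) (PP (l • a14) 0 0 0)) 
    (h12 : hinner a11 a12 = 0) (h13 : hinner a11 a13 = 0) (h14 : hinner a11 a14 = 0) : False := by
  have hz := fun w => AzL _ _ _ _ _ _ _ hA w _ _ rfl rfl
  have h41 : hinner a14 a11 = 0 := by rw [← hinner_conj, h14, map_zero]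
  have h21 : hinner a12 a11 = 0 := by rw [← hinner_conj, h12, map_zero]
  have h31 : hinner a13 a11 = 0 := by rw [← hinner_conj, h13, map_zero]
  simp only [L, hinner_zero, zero_hinner, mul_zero, add_zero, zero_add, sub_zero, hinner_smul_left, hinner_smul_right,
    h12, h13, h14, h41, h21, h31] at hz
  obtain ⟨-, p1, -⟩ := coeffs 0 (hinner a11 a11 + l * (starRingEnd ℂ) l * hinner a14 a14 - 4) 0 0 0 0 0 0 0
    (fun w => by linear_combination (hz w).1)
  obtain ⟨-, -, p2, p23, p24, -⟩ := coeffs 0 0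
    (hinner a12 a12 + hinner a11 a11 * (l * (starRingEnd ℂ) l * hinner a14 a14) - 6)
    (hinner a12 a13) (hinner a12 a14) 0 0 0 0
    (fun w => by linear_combination (hz w).2.1)
  have p32 : hinner a13 a12 = 0 := by rw [← hinner_conj, p23, map_zero]
  have p42 : hinner a14 a12 = 0 := by rw [← hinner_conj, p24, map_zero]
  simp only [p23, p24, p32, p42, mul_zero, add_zero, zero_add, sub_zero, zero_mul] at hz
  obtain ⟨-, -, -, p3, p34, -⟩ := coeffs 0 0 0
    (hinner a13 a13 + hinner a12 a12 * (l * (starRingEnd ℂ) l * hinner a14 a14) - 4)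
    (hinner a13 a14) 0 0 0 0
    (fun w => by linear_combination (hz w).2.2.1)
  have p43 : hinner a14 a13 = 0 := by rw [← hinner_conj, p34, map_zero]
  simp only [p34, p43, mul_zero, add_zero, zero_add, sub_zero, zero_mul] at hz
  obtain ⟨-, -, -, -, p4, -⟩ := coeffs 0 0 0 0
    (hinner a14 a14 + hinner a13 a13 * (l * (starRingEnd ℂ) l * hinner a14 a14) - 1) 0 0 0 0
    (fun w => by linear_combination (hz w).2.2.2.1)
  obtain ⟨b0, -, -, b1⟩ := Bpoly _ _ _ _ _ _ _ _ hB
  simp only [hinner_zero, zero_hinner, hinner_smul_left, hinner_smul_right, h14, h41, p24, p42, mul_zero, zero_mul, neg_zero, add_zero] at b0 b1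
  have hl' : (starRingEnd ℂ) l ≠ 0 := by simpa using hl
  have hs : l * (starRingEnd ℂ) l * hinner a14 a14 ≠ 0 := by positivity
  have e1 : hinner a12 a12 = hinner a11 a11 := by
    apply mul_right_cancel₀ hs
    linear_combination b1 / 4 - b0
  have e2 : (l * (starRingEnd ℂ) l * hinner a14 a14 - 1) * (l * (starRingEnd ℂ) l * hinner a14 a14 - 2) = 0 := by
    linear_combination -p2 + e1 + p1 * (1 + l * (starRingEnd ℂ) l * hinner a14 a14)
  rcases mul_eq_zero.mp e2 with e | e
  · apply he
    linear_combination p4 - p3 + (hinner a12 a12 - hinner a13 a13) * e + e1 + p1 - e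
  · have q1 : hinner a11 a11 = 2 := by linear_combination p1 - e
    have q2 : hinner a12 a12 = 2 := by rw [e1, q1]
    have q3 : hinner a13 a13 = 0 := by linear_combination p3 - hinner a12 a12 * e - 2 * q2
    have q4 : hinner a14 a14 = 1 := by rw [q3] at p4; linear_combination p4
    have h := polarB c _ _ _ _ _ _ _ _ _ _ _ _ _ _ _ _ rfl rfl rfl rfl rfl rfl rfl rfl hB 1 1
    simp only [PP_dot, PQ_dot] at h
    simp only [dot_PP, dot_PQ, ← hinner_eq] at h
    simp only [hinner_zero, zero_hinner, hinner_smul_left, hinner_smul_right, h12, h13, h14, h41, h21, h31,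
      p23, p24, p32, p42, p34, p43, q1, q2, q3, q4] at h
    rw [q4] at e b0
    rw [q1] at b0
    simp [Matrix.det_succ_row_zero, Fin.sum_univ_succ, Fin.succAbove] at h
    have : (36 : ℂ) = 0 := by
      linear_combination (14 - 32) * e - h + 16 * b0
    norm_num at this

theorem main_thm {n : ℕ} (c : ℝ) (a11 a21 a12 a22 a13 a23 a14 : Fin n → ℂ)
    (he : hinner a14 a14 ≠ 0)
    (hA : CondA 4 (PP a11 a12 a13 a14) (PP a21 a22 a23 0))
    (hB : CondB 4 c (PP a11 a12 a13 a14) (PP a21 a22 a23 0)) : hinner a21 a14 = 0 := by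
  by_contra hS
  obtain ⟨A11, A12, A13, A14, A22, A55, A66, A77⟩ := Apoly _ _ _ _ _ _ _ hA
  obtain ⟨B00, B01, B04, B11⟩ := Bpoly _ _ _ _ _ _ _ _ hB
  obtain ⟨v, rfl⟩ := wedge a14 a23 he (by linear_combination A77)
  obtain ⟨k, hk⟩ := wedge a14 (a22 - v • a13) he (by
    simp only [hinner_sub_left, hinner_sub_right, hinner_smul_left, hinner_smul_right] at A66 ⊢
    linear_combination A66)
  have hk' : a22 = k • a14 + v • a13 := by rw [← hk]; simp
  subst hk'
  have hv : v = 0 := by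
    simp only [hinner_add_left, hinner_add_right, hinner_smul_left, hinner_smul_right] at A13 B04
    rw [A14] at B04
    have e1 : (starRingEnd ℂ) v * hinner a11 a13 * hinner a21 a14 = 0 := by linear_combination B04
    have e2 : ((starRingEnd ℂ) v * hinner a21 a14) ^ 2 = 0 := by
      linear_combination (starRingEnd ℂ) v * hinner a21 a14 * A13 - e1
    have e3 := pow_eq_zero_iff (two_ne_zero) |>.mp e2
    simpa [hS] using e3
  subst hv
  simp only [zero_smul, add_zero] at *
  clear hk A77 A66 B04
  obtain ⟨l, hl⟩ := wedge a14 (a21 - k • a13) he (by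
    simp only [hinner_sub_left, hinner_sub_right, hinner_smul_left, hinner_smul_right, hinner_zero, zero_hinner] at A55 ⊢
    linear_combination A55)
  have hl' : a21 = l • a14 + k • a13 := by rw [← hl]; simp
  simp only [hinner_zero, add_zero, hinner_smul_left, hinner_smul_right] at A11 A12 A13 A14 A22 B00 B01 B11
  have h1121 : hinner a11 a21 = 0 := by
    rw [hl', hinner_add_right, hinner_smul_right, hinner_smul_right, A13, A14]; simp
  have h2111 : hinner a21 a11 = 0 := by rw [← hinner_conj, h1121, map_zero]
  have h1411 : hinner a14 a11 = 0 := by rw [← hinner_conj, A14, map_zero]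
  simp only [h1121, h2111, A14, h1411, mul_zero, zero_mul, neg_zero, add_zero] at A22 B00 B01 B11
  by_cases hk0 : k = 0
  · subst hk0
    simp only [zero_smul, add_zero] at hl' hA hB
    subst hl'
    have hl0 : l ≠ 0 := by
      rintro rfl
      apply hS
      simp [zero_hinner]
    refine caseZero c a11 a12 a13 a14 l he hl0 hA hB ?_ A13 A14
    simpa using A12
  · have hkc : (starRingEnd ℂ) k ≠ 0 := by simpa using hk0
    have ePQ : hinner a11 a11 = hinner a21 a21 := by
      have : (2 * ((starRingEnd ℂ) k * hinner a21 a14)) ≠ 0 :=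
        mul_ne_zero two_ne_zero (mul_ne_zero hkc hS)
      apply mul_left_cancel₀ this
      linear_combination B01 - 2 * hinner a21 a21 * A12
    have eP : hinner a11 a11 = 2 := by linear_combination A11 / 2 + ePQ / 2
    have eQ : hinner a21 a21 = 2 := by rw [← ePQ, eP]
    have h1112 : hinner a11 a12 = - ((starRingEnd ℂ) k * hinner a21 a14) := by linear_combination A12
    have h1211 : hinner a12 a11 = - (k * hinner a14 a21) := by
      rw [← hinner_conj, h1112]; simp [hinner_conj]
    have := normSq_sum (hinner a12 a21) ((starRingEnd ℂ) k * hinner a21 a14) (by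
      simp only [map_mul, hinner_conj, Complex.conj_conj]
      rw [eP, eQ] at A22 B00 
      rw [eP, eQ, h1112, h1211] at B11
      linear_combination -B11 / 4 + B00 + 2 * A22)
    simp [hk0, hS] at this

theorem stmt10 (n : ℕ) (hn : 0 < n) (a11 a21 a12 a22 a13 a23 a14 a24 : Fin n → ℂ)
    (c mu : ℝ) (hc : 0 < c) (hmu : 0 < mu)
    (ha14 : a14 = fun (j : Fin n) => if (j : ℕ) = 0 then ((mu : ℝ) : ℂ) else 0)
    (ha24 : a24 = 0)
    (hA : CondA 4 (fun z => z • a11 + z ^ 2 • a12 + z ^ 3 • a13 + z ^ 4 • a14)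
      (fun z => z • a21 + z ^ 2 • a22 + z ^ 3 • a23 + z ^ 4 • a24))
    (hB : CondB 4 c (fun z => z • a11 + z ^ 2 • a12 + z ^ 3 • a13 + z ^ 4 • a14)
      (fun z => z • a21 + z ^ 2 • a22 + z ^ 3 • a23 + z ^ 4 • a24)) :
    a21 ⟨0, hn⟩ = 0 := by
  subst ha24
  have hm : ∀ x : Fin n → ℂ, hinner x a14 = x ⟨0, hn⟩ * mu := by
    intro x
    unfold hinner
    rw [Finset.sum_eq_single ⟨0, hn⟩]
    · simp [ha14]
    · intro j _ hj
      have : (j : ℕ) ≠ 0 := fun h => hj (Fin.ext h)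
      simp [ha14, this]
    · simp
  have hmu' : (mu : ℂ) ≠ 0 := by exact_mod_cast hmu.ne'
  have he : hinner a14 a14 ≠ 0 := by
    rw [hm]
    simp [ha14, hmu']
  have h := main_thm c a11 a21 a12 a22 a13 a23 a14 he hA hB
  rw [hm] at h
  simpa [hmu'] using h
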